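/- Let n be a positive even integer and let a be an integer with 0 ≤ a ≤ n/2. Then C(n, n/2 − a)/C(n, n/2) ≤ e^{−a(a−1)/n}. -/

import Mathlib

/-- Moving one step away from the centre multiplies the central binomial coefficient
`C(2m, m - a)` by at most `e^{-a/m}`. -/
theorem choose_pred_le_choose_mul_exp {m a k : ℕ} (hm : m = a + 1 + k) :
    ((2 * m).choose k : ℝ) ≤ (2 * m).choose (k + 1) * Real.exp (-(a : ℝ) / m) := by
  have hrec : ((2 * m).choose (k + 1) : ℝ) * (k + 1) = (2 * m).choose k * (m + a + 1) := by
    have h := Nat.choose_succ_right_eq (2 * m) k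
    rw [show 2 * m - k = m + a + 1 by omega] at h
    exact_mod_cast h
  have hmR : (m : ℝ) = a + 1 + k := by exact_mod_cast hm
  have hm0 : (0 : ℝ) < m := by rw [hmR]; positivity
  have hd : (0 : ℝ) < m + a + 1 := by positivity
  have hratio : ((k : ℝ) + 1) / (m + a + 1) ≤ Real.exp (-(a : ℝ) / m) := by
    refine le_trans ?_ (Real.add_one_le_exp _)
    rw [div_add_one hm0.ne', div_le_div_iff₀ hd hm0, hmR]
    have : (0 : ℝ) ≤ a * k + k + a + 1 := by positivity
    nlinarith
  calc ((2 * m).choose k : ℝ)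
      = (2 * m).choose (k + 1) * (((k : ℝ) + 1) / (m + a + 1)) := by
        rw [← mul_div_assoc, hrec, mul_div_cancel_right₀ _ hd.ne']
    _ ≤ _ := by gcongr

theorem choose_sub_le_centralBinom_mul_exp {m a : ℕ} (ha : a ≤ m) :
    ((2 * m).choose (m - a) : ℝ) ≤
      (2 * m).choose m * Real.exp (-((a : ℝ) * ((a : ℝ) - 1)) / (2 * m : ℕ)) := by
  induction a with
  | zero => simp
  | succ a ih =>
    obtain ⟨k, hk⟩ := Nat.exists_eq_add_of_le ha
    have hm0 : (m : ℝ) ≠ 0 := by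
      have : m ≠ 0 := by omega
      exact_mod_cast this
    have hstep := choose_pred_le_choose_mul_exp hk
    have ih := ih (by omega)
    rw [show m - a = k + 1 by omega] at ih
    rw [show m - (a + 1) = k by omega]
    calc ((2 * m).choose k : ℝ)
        ≤ (2 * m).choose (k + 1) * Real.exp (-(a : ℝ) / m) := hstep
      _ ≤ (2 * m).choose m * Real.exp (-((a : ℝ) * ((a : ℝ) - 1)) / (2 * m : ℕ)) *
            Real.exp (-(a : ℝ) / m) := by gcongr
      _ = _ := by
        rw [mul_assoc, ← Real.exp_add]
        congr 2
        push_cast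
        field_simp
        ring

/-- Lemma 4.3 (binomial): for `n` positive and even and `0 ≤ a ≤ n/2`,
`C(n, n/2 - a)/C(n, n/2) ≤ e^{-a(a-1)/n}`. -/
theorem binomial_ratio_bound (n : ℕ) (hn : Even n) (hpos : 0 < n)
    (a : ℕ) (ha : a ≤ n / 2) :
    (n.choose (n / 2 - a) : ℝ) / (n.choose (n / 2) : ℝ) ≤
      Real.exp (-((a : ℝ) * ((a : ℝ) - 1)) / n) := by
  obtain ⟨m, rfl⟩ := hn.two_dvd
  rw [Nat.mul_div_cancel_left m two_pos] at ha ⊢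
  have hc : (0 : ℝ) < (2 * m).choose m := by
    exact_mod_cast Nat.choose_pos (by omega)
  rw [div_le_iff₀' hc]
  exact choose_sub_le_centralBinom_mul_exp ha
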